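/- Let d be a real number with 0 ≤ d < 1/2. Then the iterated integral ∫₀¹∫₀^{y₁}∫₀^{y₂}∫₀^{y₃}∫₀^{y₄} (y₂−y₃)^(−d)(y₁−y₄)^(−d)(y₂−y₄)^(−d)(y₁−y₅)^(−d)(y₃−y₅)^(−d) dy₅ dy₄ dy₃ dy₂ dy₁ equals (Γ(1−d)²/(3(1−d)²))·(Γ(4−5d)/(Γ(6−5d)·Γ(2−2d)))·₃F₂(1, d, 3−3d; 2−d, 4−3d; 1) − (Γ(1−d)·Γ(4−5d)·Γ(3−3d)/(2(1−d)²·Γ(6−5d)·Γ(4−4d)))·₃F₂(1, d, 2−2d; 2−d, 3−2d; 1). -/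

import Mathlib

open Real

noncomputable def poch (a : ℝ) (k : ℕ) : ℝ := ∏ i ∈ Finset.range k, (a + i)

noncomputable def F21 (a b c x : ℝ) : ℝ :=
  ∑' k : ℕ, poch a k * poch b k / (poch c k * (Nat.factorial k : ℝ)) * x ^ k

noncomputable def F32 (a b c e f : ℝ) : ℝ :=
  ∑' k : ℕ, poch a k * poch b k * poch c k / (poch e k * poch f k * (Nat.factorial k : ℝ))

noncomputable def F32x (a b c e f x : ℝ) : ℝ :=
  ∑' k : ℕ, poch a k * poch b k * poch c k / (poch e k * poch f k * (Nat.factorial k : ℝ)) * x ^ k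

noncomputable def F43 (a b c g e f h : ℝ) : ℝ :=
  ∑' k : ℕ, poch a k * poch b k * poch c k * poch g k /
    (poch e k * poch f k * poch h k * (Nat.factorial k : ℝ))

section StmtAux
open MeasureTheory
open scoped ENNReal

noncomputable def psi (p t : ℝ) : ℝ≥0∞ := if 0 < t then ENNReal.ofReal (t ^ p) else 0

lemma psi_pos {p t : ℝ} (h : 0 < t) : psi p t = ENNReal.ofReal (t ^ p) := by simp [psi, h]

lemma psi_np {p t : ℝ} (h : t ≤ 0) : psi p t = 0 := by simp [psi, h.not_gt]

lemma psi_ne_top (p t : ℝ) : psi p t ≠ ∞ := by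
  unfold psi; split_ifs <;> simp

@[fun_prop]
lemma psi_meas (p : ℝ) : Measurable (psi p) := by
  unfold psi
  apply Measurable.ite measurableSet_Ioi
  · fun_prop
  · fun_prop

@[fun_prop]
lemma psi_meas' {α : Type*} [MeasurableSpace α] (p : ℝ) (f : α → ℝ) (hf : Measurable f) :
    Measurable (fun x => psi p (f x)) := (psi_meas p).comp hf

@[fun_prop]
lemma lint_meas' {α : Type*} [MeasurableSpace α] (f : α → ℝ → ℝ≥0∞)
    (hf : Measurable (fun q : α × ℝ => f q.1 q.2)) :
    Measurable (fun x => ∫⁻ y, f x y) := Measurable.lintegral_prod_right hf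

lemma psi_mul_psi (p q t : ℝ) : psi p t * psi q t = psi (p + q) t := by
  by_cases h : 0 < t
  · rw [psi_pos h, psi_pos h, psi_pos h, ← ENNReal.ofReal_mul (by positivity), rpow_add h]
  · simp [psi, h]

lemma psi_scale {s : ℝ} (p t : ℝ) (hs : 0 < s) : psi p (s * t) = psi p s * psi p t := by
  by_cases h : 0 < t
  · rw [psi_pos h, psi_pos hs, psi_pos (by positivity), ← ENNReal.ofReal_mul (by positivity),
      mul_rpow hs.le h.le]
  · rw [psi_np (not_lt.1 h), psi_np (by nlinarith), mul_zero]

lemma psi_one (p : ℝ) : psi p 1 = 1 := by rw [psi_pos one_pos]; simp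

lemma lint_affine (f : ℝ → ℝ≥0∞) (hf : Measurable f) (a : ℝ) {s : ℝ} (hs : s ≠ 0) :
    ∫⁻ x, f x = ENNReal.ofReal |s| * ∫⁻ x, f (a + s * x) := by
  rw [← lintegral_add_left_eq_self f a]
  conv_lhs => rw [← Real.smul_map_volume_mul_left hs]
  rw [lintegral_smul_measure, lintegral_map (by fun_prop) (by fun_prop)]
  rfl

lemma beta_unit {a b : ℝ} (ha : -1 < a) (hb : -1 < b) :
    ∫⁻ x, psi a x * psi b (1 - x) = ENNReal.ofReal (ProbabilityTheory.beta (a+1) (b+1)) := by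
  have hB := ProbabilityTheory.beta_pos (show 0 < a + 1 by linarith) (show 0 < b + 1 by linarith)
  have h := ProbabilityTheory.lintegral_betaPDF_eq_one (show 0 < a + 1 by linarith) (show 0 < b + 1 by linarith)
  have e : ∀ x, psi a x * psi b (1 - x) = ENNReal.ofReal (ProbabilityTheory.beta (a+1) (b+1)) *
      ProbabilityTheory.betaPDF (a+1) (b+1) x := by
    intro x
    rw [ProbabilityTheory.betaPDF_eq]
    by_cases h1 : 0 < x
    · by_cases h2 : x < 1
      · have h3 : 0 < 1 - x := by linarith
        rw [if_pos ⟨h1, h2⟩, psi_pos h1, psi_pos h3, ← ENNReal.ofReal_mul (by positivity),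
          ← ENNReal.ofReal_mul hB.le]
        congr 1
        field_simp
        simp
      · rw [if_neg (by tauto), psi_np (show 1 - x ≤ 0 by linarith)]; simp
    · rw [if_neg (by tauto), psi_np (not_lt.1 h1)]; simp
  simp_rw [e]
  rw [lintegral_const_mul' _ _ ENNReal.ofReal_ne_top, h, mul_one]

lemma beta_conv {a b : ℝ} (ha : -1 < a) (hb : -1 < b) (s : ℝ) :
    ∫⁻ x, psi a x * psi b (s - x) =
      ENNReal.ofReal (ProbabilityTheory.beta (a+1) (b+1)) * psi (a + b + 1) s := by
  by_cases hs : 0 < s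
  · rw [lint_affine (fun x => psi a x * psi b (s - x)) (by fun_prop) 0 hs.ne']
    have : ∀ x, psi a (0 + s * x) * psi b (s - (0 + s * x)) =
        (psi a s * psi b s) * (psi a x * psi b (1 - x)) := by
      intro x
      rw [zero_add, show s - s * x = s * (1 - x) by ring, psi_scale _ _ hs, psi_scale _ _ hs]
      ring
    simp_rw [this]
    rw [lintegral_const_mul _ (by fun_prop), beta_unit ha hb, ← psi_mul_psi, ← psi_mul_psi,
      psi_pos (p := 1) hs, abs_of_pos hs, rpow_one]
    ring
  · rw [psi_np (not_lt.1 hs), mul_zero]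
    rw [← lintegral_zero (μ := (volume : Measure ℝ))]
    congr 1; ext x
    by_cases hx : 0 < x
    · rw [psi_np (show s - x ≤ 0 by linarith), mul_zero]
    · rw [psi_np (not_lt.1 hx), zero_mul]

lemma beta_one_right {a : ℝ} (ha : 0 < a) : ProbabilityTheory.beta a 1 = 1 / a := by
  unfold ProbabilityTheory.beta
  have := Real.Gamma_pos_of_pos ha
  rw [Real.Gamma_add_one ha.ne', Real.Gamma_one]; field_simp

lemma binom_series {d x : ℝ} (hx0 : 0 < x) (hx : x < 1) :
    HasSum (fun k : ℕ => poch d k / (Nat.factorial k : ℝ) * x ^ k) ((1 - x) ^ (-d)) := by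
  have h := (Real.one_div_one_sub_rpow_hasFPowerSeriesOnBall_zero d).hasSum (y := x) (by
    simp [enorm_eq_nnnorm]
    rw [← NNReal.coe_lt_coe]; simp [abs_of_pos hx0, hx])
  have e : ∀ n : ℕ, Ring.choose (d + n - 1) n = poch d n / (Nat.factorial n : ℝ) := by
    intro n
    rw [eq_div_iff (by positivity)]
    have h1 := Ring.descPochhammer_eq_factorial_smul_choose (d + n - 1) n
    have h2 := Ring.factorial_nsmul_multichoose_eq_ascPochhammer d n
    rw [Ring.choose, show d + n - 1 - n + 1 = d by ring, mul_comm, ← nsmul_eq_mul, h2]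
    rw [Polynomial.ascPochhammer_smeval_eq_eval]
    clear h1 h2
    induction n with
    | zero => simp [poch]
    | succ m ih => rw [ascPochhammer_succ_eval, ih]; simp [poch, Finset.prod_range_succ]
  simp only [FormalMultilinearSeries.ofScalars_apply_eq, e, zero_add] at h
  rw [rpow_neg (by linarith), ← one_div]
  simpa using h

noncomputable def JJ (d p : ℝ) : ℝ≥0∞ :=
  ∫⁻ u, ∫⁻ v, psi 0 (1-u) * psi 0 v * psi (-d) (u-v) * psi (-d) (1-v) * psi p u

lemma poch_nonneg {d : ℝ} (h : 0 ≤ d) (k : ℕ) : 0 ≤ poch d k :=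
  Finset.prod_nonneg fun i _ => by positivity

lemma poch_pos {d : ℝ} (h : 0 < d) (k : ℕ) : 0 < poch d k :=
  Finset.prod_pos fun i _ => by positivity

lemma poch_succ (d : ℝ) (k : ℕ) : poch d (k+1) = poch d k * (d + k) := by
  simp [poch, Finset.prod_range_succ]

lemma poch_one (k : ℕ) : poch 1 k = (Nat.factorial k : ℝ) := by
  induction k with
  | zero => simp [poch]
  | succ n ih => rw [poch_succ, ih, Nat.factorial_succ]; push_cast; ring

lemma poch_shift (a : ℝ) (k : ℕ) : poch (a+1) k * a = poch a k * (a + k) := by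
  induction k with
  | zero => simp [poch]
  | succ n ih => 
    rw [poch_succ, poch_succ]; push_cast
    linear_combination (a + 1 + n) * ih

lemma Gamma_poch {a : ℝ} (ha : 0 < a) (k : ℕ) : Real.Gamma (a + k) = poch a k * Real.Gamma a := by
  induction k with
  | zero => simp [poch]
  | succ n ih => 
    rw [poch_succ]; push_cast
    rw [← add_assoc, Real.Gamma_add_one (by positivity), ih]; ring

lemma JJ_tsum {d p : ℝ} (h0 : 0 ≤ d) (h1 : d < 1/2) (hp : -1 < p) :
    JJ d p = ∑' k : ℕ, ENNReal.ofReal (poch d k / (Nat.factorial k : ℝ)) *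
      (ENNReal.ofReal (ProbabilityTheory.beta (k+1) (-d+1)) *
        ENNReal.ofReal (ProbabilityTheory.beta (p + (k + -d + 1) + 1) (0+1))) := by
  have e : ∀ u v, psi 0 (1-u) * psi 0 v * psi (-d) (u-v) * psi (-d) (1-v) * psi p u =
      ∑' k : ℕ, (ENNReal.ofReal (poch d k / (Nat.factorial k : ℝ)) * (psi 0 (1-u) * psi p u)) *
        (psi k v * psi (-d) (u-v)) := by
    intro u v
    by_cases hv : 0 < v
    swap
    · simp [psi_np (not_lt.1 hv)]
    by_cases huv : 0 < u - v
    swap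
    · simp [psi_np (not_lt.1 huv)]
    by_cases hu : 0 < 1 - u
    swap
    · simp [psi_np (not_lt.1 hu)]
    have hs := binom_series (d := d) hv (show v < 1 by linarith)
    have : psi (-d) (1 - v) = ∑' k : ℕ, ENNReal.ofReal (poch d k / (Nat.factorial k : ℝ)) * psi k v := by
      rw [psi_pos (by linarith), ← hs.tsum_eq, ENNReal.ofReal_tsum_of_nonneg _ hs.summable]
      · congr 1; ext k
        have := poch_nonneg h0 k
        rw [psi_pos hv, ENNReal.ofReal_mul (by positivity), Real.rpow_natCast]
      · intro k
        have := poch_nonneg h0 k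
        positivity
    rw [this, show psi 0 v = 1 by rw [psi_pos hv]; simp, mul_one, mul_right_comm, 
      ← ENNReal.tsum_mul_left]
    congr 1; ext k; ring
  unfold JJ
  simp_rw [e]
  simp_rw [fun u => lintegral_tsum (μ := volume) (fun (k : ℕ) => ((by fun_prop : Measurable fun v =>
    (ENNReal.ofReal (poch d k / (Nat.factorial k : ℝ)) * (psi 0 (1-u) * psi p u)) *
        (psi k v * psi (-d) (u-v))).aemeasurable))]
  rw [lintegral_tsum (fun (k : ℕ) => (by fun_prop : Measurable fun u => ∫⁻ v,
    (ENNReal.ofReal (poch d k / (Nat.factorial k : ℝ)) * (psi 0 (1-u) * psi p u)) *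
        (psi k v * psi (-d) (u-v))).aemeasurable)]
  congr 1; ext k
  have hk : (0:ℝ) ≤ k := by positivity
  simp_rw [fun u => lintegral_const_mul (μ := volume)
    (ENNReal.ofReal (poch d k / (Nat.factorial k : ℝ)) * (psi 0 (1-u) * psi p u))
    (by fun_prop : Measurable fun v => (psi k v * psi (-d) (u-v))),
    beta_conv (show -1 < (k:ℝ) by linarith) (show -1 < -d by linarith)]
  rw [← beta_unit (a := p + (k + -d + 1)) (b := 0) (by linarith) (by linarith), ← lintegral_const_mul _ (by fun_prop), 
    ← lintegral_const_mul _ (by fun_prop)]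
  congr 1; ext u
  rw [← psi_mul_psi p]
  ring

lemma JJ_toReal {d p : ℝ} (h0 : 0 ≤ d) (h1 : d < 1/2) (hp : -1 < p) :
    (JJ d p).toReal = 1 / ((1-d) * (2-d+p)) * F32 1 d (2-d+p) (2-d) (3-d+p) := by
  rw [JJ_tsum h0 h1 hp, ENNReal.tsum_toReal_eq (by finiteness), F32, ← tsum_mul_left]
  congr 1; ext k
  have hk : (0:ℝ) ≤ k := by positivity
  have b1 := ProbabilityTheory.beta_pos (show 0 < (k:ℝ) + 1 by linarith) (show 0 < -d + 1 by linarith)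
  have hpd := poch_nonneg h0 k
  rw [zero_add, beta_one_right (by linarith)]
  rw [ENNReal.toReal_mul, ENNReal.toReal_mul, ENNReal.toReal_ofReal (by positivity), 
    ENNReal.toReal_ofReal b1.le, ENNReal.toReal_ofReal 
    (one_div_nonneg.2 (show 0 ≤ p + (k + -d + 1) + 1 by linarith))]
  unfold ProbabilityTheory.beta
  rw [poch_one, Real.Gamma_nat_eq_factorial, show (k:ℝ) + 1 + (-d+1) = (2 - d) + k by ring, 
    Gamma_poch (by linarith), show 2 - d = (-d + 1) + 1 by ring, Real.Gamma_add_one (s := -d + 1) (by linarith),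
    show 3 - d + p = (2 - d + p) + 1 by ring, show p + (k + -d + 1) + 1 = 2 - d + p + k by ring,
    show -d + 1 + 1 + p = 2 - d + p by ring]
  have hs := poch_shift (2 - d + p) k
  have p1 := poch_pos (show 0 < 2 - d + p by linarith) k
  have p2 := poch_pos (show 0 < 2 - d + p + 1 by linarith) k
  have p3 := poch_pos (show 0 < -d + 1 + 1 by linarith) k
  have g1 := Real.Gamma_pos_of_pos (show 0 < -d + 1 by linarith)
  have q1 : 0 < 2 - d + p := by linarith
  have q2 : 0 < 2 - d + p + k := by linarith
  have q3 : 0 < 1 - d := by linarith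
  have q4 : 0 < -d + 1 := by linarith
  generalize 2 - d + p = a at *
  have : poch a k / poch (a+1) k = a / (a + k) := by
    rw [div_eq_div_iff p2.ne' q2.ne']; linarith
  have hf : (Nat.factorial k : ℝ) ≠ 0 := by positivity
  calc _ = poch d k / ((1 - d) * a * poch (-d+1+1) k) * (a / (a + k)) := by
        rw [show -d + 1 = 1 - d by ring] at *
        field_simp
    _ = _ := by
        rw [← this]; field_simp

lemma JJ_ne_top {d p : ℝ} (h0 : 0 ≤ d) (h1 : d < 1/2) (hp : -1 < p - 2 * d + 1) :
    JJ d p ≠ ∞ := by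
  have : JJ d p ≤ ∫⁻ u, (psi 0 (1-u) * psi p u) * ∫⁻ v, psi 0 v * psi (-d-d) (u-v) := by
    unfold JJ
    refine lintegral_mono fun u => ?_
    rw [← lintegral_const_mul _ (by fun_prop)]
    refine lintegral_mono fun v => ?_
    beta_reduce
    rw [show -d-d = -d + -d by ring, ← psi_mul_psi]
    by_cases huv : 0 < u - v
    swap
    · simp [psi_np (not_lt.1 huv)]
    by_cases hu : 0 < 1 - u
    swap
    · simp [psi_np (not_lt.1 hu)]
    have : psi (-d) (1 - v) ≤ psi (-d) (u - v) := by
      rw [psi_pos (by linarith), psi_pos huv]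
      apply ENNReal.ofReal_le_ofReal
      exact Real.rpow_le_rpow_of_nonpos huv (by linarith) (by linarith)
    calc _ = psi 0 (1 - u) * psi p u * (psi 0 v * (psi (-d) (u - v) * psi (-d) (1 - v))) := by ring
      _ ≤ _ := by gcongr
  refine ne_top_of_le_ne_top ?_ this
  simp_rw [beta_conv (show (-1:ℝ) < 0 by norm_num) (show -1 < -d-d by linarith)]
  have e : ∀ u, psi 0 (1-u) * psi p u * (ENNReal.ofReal (ProbabilityTheory.beta (0+1) (-d-d+1)) * psi (0+(-d-d)+1) u) 
    = ENNReal.ofReal (ProbabilityTheory.beta (0+1) (-d-d+1)) * (psi (p + (0+(-d-d)+1)) u * psi 0 (1-u)) := by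
    intro u; rw [← psi_mul_psi p]; ring
  simp_rw [e]
  rw [lintegral_const_mul _ (by fun_prop), beta_unit (by linarith) (by linarith)]
  finiteness

lemma lint_swap (f : ℝ → ℝ → ℝ≥0∞) (hf : Measurable (fun q : ℝ × ℝ => f q.1 q.2)) :
    ∫⁻ x, ∫⁻ y, f x y = ∫⁻ y, ∫⁻ x, f x y :=
  lintegral_lintegral_swap hf.aemeasurable

noncomputable def CC (d : ℝ) : ℝ≥0∞ :=
  ∫⁻ b, ∫⁻ c, ∫⁻ e, psi 0 e * psi 0 (c-e) * psi 0 (1-b) *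
    (psi (-d) (b-c) * psi (-d) (1-e) * psi (-d) (b-e) * psi (-d) c)

noncomputable def DD (d : ℝ) : ℝ≥0∞ :=
  ∫⁻ b, ∫⁻ c, ∫⁻ e, psi 0 c * psi 0 (e-c) * psi 0 (1-b) *
    (psi (-d) (b-c) * psi (-d) (1-e) * psi (-d) (b-e) * psi (-d) c)

lemma psi_zero {t : ℝ} (h : 0 < t) : psi 0 t = 1 := by simp [psi, h]

lemma CC_add_DD {d : ℝ} (h0 : 0 ≤ d) (h1 : d < 1/2) :
    CC d + DD d = ENNReal.ofReal (ProbabilityTheory.beta (-d+1) (-d+1)) * JJ d (1-2*d) := by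
  unfold CC DD JJ
  rw [← lintegral_add_left (by fun_prop), ← lintegral_const_mul _ (by fun_prop)]
  congr 1; ext b
  rw [← lintegral_add_left (by fun_prop)]
  have key : ∀ c, (∫⁻ e, psi 0 e * psi 0 (c-e) * psi 0 (1-b) *
    (psi (-d) (b-c) * psi (-d) (1-e) * psi (-d) (b-e) * psi (-d) c)) + 
    (∫⁻ e, psi 0 c * psi 0 (e-c) * psi 0 (1-b) *
    (psi (-d) (b-c) * psi (-d) (1-e) * psi (-d) (b-e) * psi (-d) c)) = 
    (psi (-d) c * psi (-d) (b-c)) * ∫⁻ e, psi 0 (1-b) * psi 0 e * psi (-d) (b-e) * psi (-d) (1-e) := by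
    intro c
    rw [← lintegral_add_left (by fun_prop), ← lintegral_const_mul _ (by fun_prop)]
    apply lintegral_congr_ae
    have : ∀ᵐ e : ℝ, e ≠ c := by simp [ae_iff]
    filter_upwards [this] with e he
    by_cases hc : 0 < c
    swap
    · simp [psi_np (not_lt.1 hc)]
    rw [psi_zero hc]
    rcases lt_or_gt_of_ne he with h | h
    · rw [psi_zero (show 0 < c - e by linarith), psi_np (show e - c ≤ 0 by linarith)]
      ring
    · rw [psi_zero (show 0 < e - c by linarith), psi_np (show c - e ≤ 0 by linarith), 
        psi_zero (show 0 < e by linarith)]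
      ring
  simp_rw [key]
  rw [lintegral_mul_const _ (by fun_prop), beta_conv (by linarith) (by linarith), mul_assoc,
    ← lintegral_const_mul _ (by fun_prop)]
  congr 2; ext e
  rw [show -d + -d + 1 = 1 - 2 * d by ring]; ring

lemma DD_eq {d : ℝ} (h0 : 0 ≤ d) (h1 : d < 1/2) :
    DD d = ENNReal.ofReal (ProbabilityTheory.beta (-d+1) (3-3*d)) * JJ d (-d) := by
  unfold DD
  rw [lint_swap _ (by fun_prop)]
  have key : ∀ c, ∫⁻ b, ∫⁻ e, psi 0 c * psi 0 (e-c) * psi 0 (1-b) *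
    (psi (-d) (b-c) * psi (-d) (1-e) * psi (-d) (b-e) * psi (-d) c) =
    (psi (-d) c * psi (2-3*d) (1-c)) * JJ d (-d) := by
    intro c
    by_cases hc : 0 < 1 - c
    swap
    · rw [psi_np (not_lt.1 hc), mul_zero, zero_mul]
      simp only [lintegral_eq_zero_iff (by fun_prop : Measurable fun b => ∫⁻ e, psi 0 c * psi 0 (e-c) * psi 0 (1-b) *
        (psi (-d) (b-c) * psi (-d) (1-e) * psi (-d) (b-e) * psi (-d) c))]
      refine Filter.Eventually.of_forall fun b => ?_
      simp only [Pi.zero_apply]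
      rw [lintegral_eq_zero_iff (by fun_prop)]
      refine Filter.Eventually.of_forall fun e => ?_
      simp only [Pi.zero_apply]
      by_cases hb : 0 < 1 - b
      · rw [psi_np (show b - c ≤ 0 by linarith)]; simp
      · rw [psi_np (not_lt.1 hb)]; simp
    rw [lint_swap _ (by fun_prop)]
    have hs : -(1-c) ≠ 0 := by linarith
    rw [lint_affine _ (by fun_prop) 1 hs]
    simp_rw [fun u => lint_affine (fun x => psi 0 c * psi 0 (1 + -(1-c)*u-c) * psi 0 (1-x) *
        (psi (-d) (x-c) * psi (-d) (1-(1 + -(1-c)*u)) * psi (-d) (x-(1 + -(1-c)*u)) * psi (-d) c)) (by fun_prop) 1 hs]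
    unfold JJ
    rw [← lintegral_const_mul _ (by fun_prop), ← lintegral_const_mul _ (by fun_prop)]
    congr 1; ext u
    rw [← lintegral_const_mul _ (by fun_prop), ← lintegral_const_mul _ (by fun_prop),
      ← lintegral_const_mul _ (by fun_prop)]
    congr 1; ext v
    rw [show 1 + -(1 - c) * u - c = (1-c) * (1-u) by ring, 
      show 1 - (1 + -(1 - c) * v) = (1-c) * v by ring,
      show 1 + -(1 - c) * v - c = (1-c) * (1-v) by ring,
      show 1 - (1 + -(1 - c) * u) = (1-c) * u by ring,
      show 1 + -(1 - c) * v - (1 + -(1 - c) * u) = (1-c)*(u-v) by ring]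
    simp only [psi_scale _ _ hc]
    rw [psi_zero hc, abs_neg, abs_of_pos hc, show 2 - 3*d = 1 + 1 + -d + -d + -d by ring]
    simp only [← psi_mul_psi]
    rw [psi_pos (p := 1) hc, Real.rpow_one]
    have : psi 0 c * psi (-d) c = psi (-d) c := by rw [psi_mul_psi, zero_add]
    conv_rhs => rw [← this]
    ring
  simp_rw [key]
  rw [lintegral_mul_const _ (by fun_prop), beta_unit (by linarith) (by linarith)]
  rw [show 2 - 3 * d + 1 = 3 - 3 * d by ring]

noncomputable def gg (d y1 y2 y3 y4 y5 : ℝ) : ℝ≥0∞ :=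
  psi 0 (1-y1) * (psi 0 (y1-y2) * (psi 0 (y2-y3) * (psi 0 (y3-y4) * (psi 0 (y4-y5) * (psi 0 y5 *
    (psi (-d) (y2-y3) * psi (-d) (y1-y4) * psi (-d) (y2-y4) * psi (-d) (y1-y5) * psi (-d) (y3-y5)))))))

@[fun_prop]
lemma gg_meas {α : Type*} [MeasurableSpace α] (d : ℝ) (f1 f2 f3 f4 f5 : α → ℝ) (h1 : Measurable f1)
    (h2 : Measurable f2) (h3 : Measurable f3) (h4 : Measurable f4) (h5 : Measurable f5) :
    Measurable (fun x => gg d (f1 x) (f2 x) (f3 x) (f4 x) (f5 x)) := by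
  unfold gg; fun_prop

lemma TT_eq {d : ℝ} (h0 : 0 ≤ d) (h1 : d < 1/2) :
    ∫⁻ y1, ∫⁻ y2, ∫⁻ y3, ∫⁻ y4, ∫⁻ y5, gg d y1 y2 y3 y4 y5 = 
      ENNReal.ofReal (ProbabilityTheory.beta (0+1) (3-5*d+1)) * 
      ENNReal.ofReal (ProbabilityTheory.beta (0+(3-5*d)+1+1) (0+1)) * CC d := by
  have e1 : ∀ y1 y2 y3, ∫⁻ y4, ∫⁻ y5, gg d y1 y2 y3 y4 y5 = ∫⁻ y5, ∫⁻ y4, gg d y1 y2 y3 y4 y5 :=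
    fun y1 y2 y3 => lint_swap _ (by fun_prop)
  have e2 : ∀ y1 y2, ∫⁻ y3, ∫⁻ y5, ∫⁻ y4, gg d y1 y2 y3 y4 y5 = ∫⁻ y5, ∫⁻ y3, ∫⁻ y4, gg d y1 y2 y3 y4 y5 :=
    fun y1 y2 => lint_swap _ (by fun_prop)
  have e3 : ∀ y1, ∫⁻ y2, ∫⁻ y5, ∫⁻ y3, ∫⁻ y4, gg d y1 y2 y3 y4 y5 = ∫⁻ y5, ∫⁻ y2, ∫⁻ y3, ∫⁻ y4, gg d y1 y2 y3 y4 y5 :=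
    fun y1 => lint_swap _ (by fun_prop)
  simp_rw [e1, e2, e3]
  have key : ∀ y1 y5, ∫⁻ y2, ∫⁻ y3, ∫⁻ y4, gg d y1 y2 y3 y4 y5 = 
    psi 0 (1-y1) * (psi 0 y5 * psi (3-5*d) (y1-y5)) * CC d := by
    intro y1 y5
    by_cases hc : 0 < y1 - y5
    swap
    · simp [gg, psi_np (not_lt.1 hc)]
    rw [lint_affine _ (by fun_prop) y5 hc.ne']
    simp_rw [fun u => lint_affine (fun x => ∫⁻ y4, gg d y1 u x y4 y5) (by fun_prop) y5 hc.ne']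
    simp_rw [fun u v => lint_affine (fun x => gg d y1 u v x y5) (by fun_prop) y5 hc.ne']
    unfold CC
    rw [← lintegral_const_mul _ (by fun_prop), ← lintegral_const_mul _ (by fun_prop)]
    congr 1; ext b
    rw [← lintegral_const_mul _ (by fun_prop), ← lintegral_const_mul _ (by fun_prop),
      ← lintegral_const_mul _ (by fun_prop)]
    congr 1; ext c
    rw [← lintegral_const_mul _ (by fun_prop), ← lintegral_const_mul _ (by fun_prop),
      ← lintegral_const_mul _ (by fun_prop), ← lintegral_const_mul _ (by fun_prop)]
    congr 1; ext e
    unfold gg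
    generalize hs : y1 - y5 = s at *
    rw [show y1 - (y5 + s * b) = s * (1 - b) by rw [← hs]; ring,
      show y1 - (y5 + s * e) = s * (1 - e) by rw [← hs]; ring,
      show y5 + s * b - (y5 + s * c) = s * (b - c) by ring,
      show y5 + s * c - (y5 + s * e) = s * (c - e) by ring,
      show y5 + s * b - (y5 + s * e) = s * (b - e) by ring,
      show y5 + s * e - y5 = s * e by ring,
      show y5 + s * c - y5 = s * c by ring]
    simp only [psi_scale _ _ hc]
    rw [psi_zero hc, abs_of_pos hc, show 3 - 5*d = 1 + 1 + 1 + -d + -d + -d + -d + -d by ring]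
    simp only [← psi_mul_psi]
    rw [psi_pos (p := 1) hc, Real.rpow_one]
    have : psi 0 (b-c) * psi (-d) (b-c) = psi (-d) (b-c) := by rw [psi_mul_psi, zero_add]
    conv_rhs => rw [← this]
    ring
  simp_rw [key]
  have k2 : ∀ y1, ∫⁻ y5, psi 0 (1-y1) * (psi 0 y5 * psi (3-5*d) (y1-y5)) * CC d = 
    ENNReal.ofReal (ProbabilityTheory.beta (0+1) (3-5*d+1)) * 
      (psi (0+(3-5*d)+1) y1 * psi 0 (1-y1)) * CC d := by
    intro y1
    rw [lintegral_mul_const _ (by fun_prop), lintegral_const_mul _ (by fun_prop), 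
      beta_conv (by linarith) (by linarith)]
    ring
  simp_rw [k2]
  rw [lintegral_mul_const _ (by fun_prop), lintegral_const_mul _ (by fun_prop), 
      beta_unit (by linarith) (by linarith)]

lemma int_step (G : ℝ → ℝ≥0∞) (hG : Measurable G) (R : ℝ → ℝ) {a : ℝ} (ha : 0 < a)
    (hfin : ∫⁻ y, G y ≠ ∞) (hz : ∀ y, ¬ (0 < y ∧ y < a) → G y = 0) 
    (hR : ∀ y, 0 < y → y < a → G y ≠ ∞ → R y = (G y).toReal) :
    ∫ y in (0:ℝ)..a, R y = (∫⁻ y, G y).toReal := by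
  have hf := ae_lt_top hG hfin
  rw [← integral_toReal hG.aemeasurable hf, intervalIntegral.integral_of_le ha.le, 
    integral_Ioc_eq_integral_Ioo, ← integral_indicator measurableSet_Ioo]
  apply integral_congr_ae
  filter_upwards [hf] with y hy
  by_cases h : 0 < y ∧ y < a
  · rw [Set.indicator_of_mem (by exact h), hR y h.1 h.2 hy.ne]
  · rw [Set.indicator_of_notMem (by exact h), hz y h]; rfl

lemma main_toReal {d : ℝ} 
    (hfin : ∫⁻ y1, ∫⁻ y2, ∫⁻ y3, ∫⁻ y4, ∫⁻ y5, gg d y1 y2 y3 y4 y5 ≠ ∞) : 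
    (∫ y1 in (0:ℝ)..1, ∫ y2 in (0:ℝ)..y1, ∫ y3 in (0:ℝ)..y2, ∫ y4 in (0:ℝ)..y3, ∫ y5 in (0:ℝ)..y4,
      (y2 - y3) ^ (-d) * (y1 - y4) ^ (-d) * (y2 - y4) ^ (-d) * (y1 - y5) ^ (-d) * (y3 - y5) ^ (-d)) =
    (∫⁻ y1, ∫⁻ y2, ∫⁻ y3, ∫⁻ y4, ∫⁻ y5, gg d y1 y2 y3 y4 y5).toReal := by
  have z : ∀ y1 y2 y3 y4 y5, ¬ (0 < y5 ∧ y5 < y4 ∧ y4 < y3 ∧ y3 < y2 ∧ y2 < y1 ∧ y1 < 1) →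
      gg d y1 y2 y3 y4 y5 = 0 := by
    intro y1 y2 y3 y4 y5 h
    unfold gg
    by_cases a1 : 0 < 1 - y1
    swap
    · simp [psi_np (not_lt.1 a1)]
    by_cases a2 : 0 < y1 - y2
    swap
    · simp [psi_np (not_lt.1 a2)]
    by_cases a3 : 0 < y2 - y3
    swap
    · simp [psi_np (not_lt.1 a3)]
    by_cases a4 : 0 < y3 - y4
    swap
    · simp [psi_np (not_lt.1 a4)]
    by_cases a5 : 0 < y4 - y5
    swap
    · simp [psi_np (not_lt.1 a5)]
    by_cases a6 : 0 < y5
    swap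
    · simp [psi_np (not_lt.1 a6)]
    exact absurd ⟨a6, by linarith, by linarith, by linarith, by linarith, by linarith⟩ h
  refine int_step _ (by fun_prop) _ one_pos hfin ?_ ?_
  · intro y1 hy
    simp_rw [fun y2 y3 y4 y5 => z y1 y2 y3 y4 y5 (by contrapose! hy; constructor <;> linarith)]
    simp
  intro y1 p1 q1 hfin
  refine int_step _ (by fun_prop) _ p1 hfin ?_ ?_
  · intro y2 hy
    simp_rw [fun y3 y4 y5 => z y1 y2 y3 y4 y5 (by contrapose! hy; constructor <;> linarith)]
    simp
  intro y2 p2 q2 hfin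
  refine int_step _ (by fun_prop) _ p2 hfin ?_ ?_
  · intro y3 hy
    simp_rw [fun y4 y5 => z y1 y2 y3 y4 y5 (by contrapose! hy; constructor <;> linarith)]
    simp
  intro y3 p3 q3 hfin
  refine int_step _ (by fun_prop) _ p3 hfin ?_ ?_
  · intro y4 hy
    simp_rw [fun y5 => z y1 y2 y3 y4 y5 (by contrapose! hy; constructor <;> linarith)]
    simp
  intro y4 p4 q4 hfin
  refine int_step _ (by fun_prop) _ p4 hfin ?_ ?_
  · intro y5 hy
    exact z y1 y2 y3 y4 y5 (by contrapose! hy; constructor <;> linarith)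
  intro y5 p5 q5 hfin
  have b1 : 0 < 1 - y1 := by linarith
  have b2 : 0 < y1 - y2 := by linarith
  have b3 : 0 < y2 - y3 := by linarith
  have b4 : 0 < y3 - y4 := by linarith
  have b5 : 0 < y4 - y5 := by linarith
  have c1 : 0 < y1 - y4 := by linarith
  have c2 : 0 < y2 - y4 := by linarith
  have c3 : 0 < y1 - y5 := by linarith
  have c4 : 0 < y3 - y5 := by linarith
  unfold gg
  rw [psi_zero b1, psi_zero b2, psi_zero b3, psi_zero b4, psi_zero b5, psi_zero p5, psi_pos b3,
    psi_pos c1, psi_pos c2, psi_pos c3, psi_pos c4]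
  simp only [one_mul, ENNReal.toReal_mul]
  repeat rw [ENNReal.toReal_ofReal (by positivity)]

end StmtAux

theorem stmt16 (d : ℝ) (h0 : 0 ≤ d) (h1 : d < 1/2) :
    (∫ y1 in (0:ℝ)..1, ∫ y2 in (0:ℝ)..y1, ∫ y3 in (0:ℝ)..y2, ∫ y4 in (0:ℝ)..y3, ∫ y5 in (0:ℝ)..y4,
      (y2 - y3) ^ (-d) * (y1 - y4) ^ (-d) * (y2 - y4) ^ (-d) * (y1 - y5) ^ (-d) * (y3 - y5) ^ (-d)) =
    Gamma (1-d) ^ 2 / (3 * (1-d) ^ 2) * (Gamma (4-5*d) / (Gamma (6-5*d) * Gamma (2-2*d))) *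
      F32 1 d (3-3*d) (2-d) (4-3*d) -
      Gamma (1-d) * Gamma (4-5*d) * Gamma (3-3*d) / (2 * (1-d) ^ 2 * Gamma (6-5*d) * Gamma (4-4*d)) *
      F32 1 d (2-2*d) (2-d) (3-2*d) := by
  have q1 : 0 < 1 - d := by linarith
  have hT := TT_eq h0 h1
  have hCD := CC_add_DD h0 h1
  have hD := DD_eq h0 h1
  have j1 := JJ_ne_top (p := 1-2*d) h0 h1 (by linarith)
  have j2 := JJ_ne_top (p := -d) h0 h1 (by linarith)
  have t1 := JJ_toReal (p := 1-2*d) h0 h1 (by linarith)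
  have t2 := JJ_toReal (p := -d) h0 h1 (by linarith)
  have fCD : CC d + DD d ≠ ENNReal.ofReal 0 + ⊤ := by
    rw [hCD]; simp; exact ENNReal.mul_ne_top ENNReal.ofReal_ne_top j1
  have fCD' : CC d + DD d ≠ ⊤ := by simpa using fCD
  have fC : CC d ≠ ⊤ := (ENNReal.add_ne_top.1 fCD').1
  have fD : DD d ≠ ⊤ := (ENNReal.add_ne_top.1 fCD').2
  have r1 := congrArg ENNReal.toReal hCD
  rw [ENNReal.toReal_add fC fD, ENNReal.toReal_mul, t1,
    ENNReal.toReal_ofReal (ProbabilityTheory.beta_pos (by linarith) (by linarith)).le] at r1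
  have r2 := congrArg ENNReal.toReal hD
  rw [ENNReal.toReal_mul, t2,
    ENNReal.toReal_ofReal (ProbabilityTheory.beta_pos (by linarith) (by linarith)).le] at r2
  have fT := hT.trans_ne (ENNReal.mul_ne_top (ENNReal.mul_ne_top ENNReal.ofReal_ne_top ENNReal.ofReal_ne_top) fC)
  rw [main_toReal fT, hT, ENNReal.toReal_mul, ENNReal.toReal_mul,
    ENNReal.toReal_ofReal (ProbabilityTheory.beta_pos (by linarith) (by linarith)).le,
    ENNReal.toReal_ofReal (ProbabilityTheory.beta_pos (by linarith) (by linarith)).le]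
  have r3 : (CC d).toReal = ProbabilityTheory.beta (-d+1) (-d+1) * (1 / ((1 - d) * (2 - d + (1 - 2 * d))) *
      F32 1 d (2 - d + (1 - 2 * d)) (2 - d) (3 - d + (1 - 2 * d))) -
      ProbabilityTheory.beta (-d+1) (3-3*d) * (1 / ((1 - d) * (2 - d + -d)) *
      F32 1 d (2 - d + -d) (2 - d) (3 - d + -d)) := by linarith
  rw [r3]
  rw [show 2 - d + (1 - 2 * d) = 3 - 3 * d by ring, show 3 - d + (1 - 2 * d) = 4 - 3 * d by ring,
    show 2 - d + -d = 2 - 2 * d by ring, show 3 - d + -d = 3 - 2 * d by ring]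
  unfold ProbabilityTheory.beta
  rw [show 0 + (3 - 5 * d) + 1 + 1 + (0 + 1) = 6 - 5 * d by ring,
    show 0 + (3 - 5 * d) + 1 + 1 = 5 - 5 * d by ring,
    show (0:ℝ) + 1 + (3 - 5 * d + 1) = 5 - 5 * d by ring,
    show 3 - 5 * d + 1 = 4 - 5 * d by ring,
    show -d + 1 + (-d + 1) = 2 - 2 * d by ring,
    show -d + 1 + (3 - 3 * d) = 4 - 4 * d by ring,
    show -d + 1 = 1 - d by ring, show 2 - 2 * d = 2 * (1 - d) by ring,
    show (3 - 3 * d) = 3 * (1 - d) by ring, zero_add, Real.Gamma_one]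
  have g5 := Real.Gamma_pos_of_pos (show 0 < 5 - 5 * d by linarith)
  have g6 := Real.Gamma_pos_of_pos (show 0 < 6 - 5 * d by linarith)
  have g2 := Real.Gamma_pos_of_pos (show 0 < 2 * (1 - d) by linarith)
  have g4 := Real.Gamma_pos_of_pos (show 0 < 4 - 4 * d by linarith)
  generalize Gamma (5 - 5 * d) = G5 at *
  generalize Gamma (6 - 5 * d) = G6 at *
  generalize Gamma (4 - 5 * d) = G45 at *
  generalize Gamma (2 * (1 - d)) = G2 at *
  generalize Gamma (3 * (1 - d)) = G3 at *
  generalize Gamma (4 - 4 * d) = G4 at *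
  generalize Gamma (1 - d) = G1 at *
  generalize F32 _ _ _ _ _ = Fa
  generalize F32 _ _ _ _ _ = Fb
  generalize 1 - d = q at *
  field_simp
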